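/- Let P and Q be probability measures on metric spaces, let β > 0, and for a coupling γ of P and Q define F(γ) = ∫ ρ(x, x') dγ(x, x') + β·KL(γ ‖ P ⊗ Q). If the infimum of F over all couplings of P and Q is finite and is attained by couplings γ₁ and γ₂, then γ₁ = γ₂; that is, the entropic optimal transport plan is unique. -/

import Mathlib

open MeasureTheory
open scoped ENNReal

noncomputable section

/-- A coupling of `P` and `Q`: a probability measure on the product whose marginals
are `P` and `Q`. -/
def IsCoupling {X X' : Type*} [MeasurableSpace X] [MeasurableSpace X']
    (γ : Measure (X × X')) (P : Measure X) (Q : Measure X') : Prop :=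
  IsProbabilityMeasure γ ∧ γ.map Prod.fst = P ∧ γ.map Prod.snd = Q

open Classical in
/-- Kullback–Leibler divergence (relative entropy) of `μ` with respect to `ν`. -/
def KLdiv {α : Type*} [MeasurableSpace α] (μ ν : Measure α) : ℝ≥0∞ :=
  if μ ≪ ν ∧ Integrable (llr μ ν) μ then ENNReal.ofReal (∫ x, llr μ ν x ∂μ) else ⊤

/-- Entropic optimal transport objective `F(γ) = ∫ ρ dγ + β·KL(γ ‖ P ⊗ Q)`. -/
def entOTObj {X : Type*} [MeasurableSpace X] [PseudoMetricSpace X] (β : ℝ)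
    (P Q : Measure X) (γ : Measure (X × X)) : ℝ≥0∞ :=
  (∫⁻ p, edist p.1 p.2 ∂γ) + ENNReal.ofReal β * KLdiv γ (P.prod Q)

/-- Entropic optimal transport cost `W_β(P,Q)`. -/
def Wbeta {X : Type*} [MeasurableSpace X] [PseudoMetricSpace X] (β : ℝ)
    (P Q : Measure X) : ℝ≥0∞ :=
  ⨅ γ ∈ {γ : Measure (X × X) | IsCoupling γ P Q}, entOTObj β P Q γ

open InformationTheory in
lemma KLdiv_eq_klDiv {α : Type*} [MeasurableSpace α] (μ ν : Measure α)
    [IsProbabilityMeasure μ] [IsProbabilityMeasure ν] : KLdiv μ ν = klDiv μ ν := by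
  rw [KLdiv, klDiv_def]
  simp

/-- If the midpoint does not improve on the average divergence, the measures agree. -/
lemma eq_of_klDiv_midpoint {α : Type*} [MeasurableSpace α] (μ₁ μ₂ ν : Measure α)
    [IsProbabilityMeasure μ₁] [IsProbabilityMeasure μ₂] [IsProbabilityMeasure ν]
    (h₁ : InformationTheory.klDiv μ₁ ν ≠ ⊤) (h₂ : InformationTheory.klDiv μ₂ ν ≠ ⊤)
    (h : (2 : ℝ≥0∞)⁻¹ * (InformationTheory.klDiv μ₁ ν + InformationTheory.klDiv μ₂ ν)
      ≤ InformationTheory.klDiv ((2 : ℝ≥0∞)⁻¹ • (μ₁ + μ₂)) ν) : μ₁ = μ₂ := by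
  have ac₁ : μ₁ ≪ ν := (InformationTheory.klDiv_ne_top_iff.1 h₁).1
  have ac₂ : μ₂ ≪ ν := (InformationTheory.klDiv_ne_top_iff.1 h₂).1
  have ac : (2 : ℝ≥0∞)⁻¹ • (μ₁ + μ₂) ≪ ν :=
    (Measure.AbsolutelyContinuous.add_left ac₁ ac₂).smul_left _
  have : IsFiniteMeasure ((2 : ℝ≥0∞)⁻¹ • (μ₁ + μ₂)) := Measure.smul_finite _ (by simp)
  have hd : ∀ᵐ x ∂ν, (((2 : ℝ≥0∞)⁻¹ • (μ₁ + μ₂)).rnDeriv ν x).toReal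
      = (1 / 2 : ℝ) * (μ₁.rnDeriv ν x).toReal + (1 / 2 : ℝ) * (μ₂.rnDeriv ν x).toReal := by
    filter_upwards [Measure.rnDeriv_smul_left_of_ne_top (μ₁ + μ₂) ν
      (r := (2 : ℝ≥0∞)⁻¹) (by simp), Measure.rnDeriv_add μ₁ μ₂ ν,
      μ₁.rnDeriv_lt_top ν, μ₂.rnDeriv_lt_top ν] with x a b c d
    rw [a, Pi.smul_apply, b, Pi.add_apply, smul_eq_mul, ENNReal.toReal_mul,
      ENNReal.toReal_add c.ne d.ne]
    simp
    ring
  rw [InformationTheory.klDiv_eq_lintegral_klFun_of_ac ac₁,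
    InformationTheory.klDiv_eq_lintegral_klFun_of_ac ac₂,
    InformationTheory.klDiv_eq_lintegral_klFun_of_ac ac] at h
  rw [InformationTheory.klDiv_eq_lintegral_klFun_of_ac ac₁] at h₁
  rw [InformationTheory.klDiv_eq_lintegral_klFun_of_ac ac₂] at h₂
  rw [← lintegral_add_left (by fun_prop), ← lintegral_const_mul _ (by fun_prop)] at h
  have key : ∀ a b : ℝ, 0 ≤ a → 0 ≤ b → (2 : ℝ≥0∞)⁻¹ *
      (ENNReal.ofReal (InformationTheory.klFun a) + ENNReal.ofReal (InformationTheory.klFun b))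
      = ENNReal.ofReal ((1 / 2 : ℝ) * InformationTheory.klFun a
        + (1 / 2 : ℝ) * InformationTheory.klFun b) := by
    intro a b ha hb
    have ka := InformationTheory.klFun_nonneg ha
    have kb := InformationTheory.klFun_nonneg hb
    rw [← ENNReal.ofReal_add ka kb, ← mul_add, ENNReal.ofReal_mul (by norm_num)]
    congr 1
    rw [one_div, ENNReal.ofReal_inv_of_pos (by norm_num)]
    simp
  have hle : (fun x => ENNReal.ofReal (InformationTheory.klFun
      (((2 : ℝ≥0∞)⁻¹ • (μ₁ + μ₂)).rnDeriv ν x).toReal)) ≤ᵐ[ν] fun x => (2 : ℝ≥0∞)⁻¹ *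
      (ENNReal.ofReal (InformationTheory.klFun (μ₁.rnDeriv ν x).toReal)
        + ENNReal.ofReal (InformationTheory.klFun (μ₂.rnDeriv ν x).toReal)) := by
    filter_upwards [hd] with x hx
    rw [hx, key _ _ ENNReal.toReal_nonneg ENNReal.toReal_nonneg]
    refine ENNReal.ofReal_le_ofReal ?_
    exact InformationTheory.convexOn_klFun.2 (Set.mem_Ici.2 ENNReal.toReal_nonneg)
      (Set.mem_Ici.2 ENNReal.toReal_nonneg) (by norm_num) (by norm_num) (by norm_num)
  have hfin : ∫⁻ x, ENNReal.ofReal (InformationTheory.klFun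
      (((2 : ℝ≥0∞)⁻¹ • (μ₁ + μ₂)).rnDeriv ν x).toReal) ∂ν ≠ ⊤ := by
    refine ne_top_of_le_ne_top ?_ (lintegral_mono_ae hle)
    rw [lintegral_const_mul _ (by fun_prop), lintegral_add_left (by fun_prop)]
    exact ENNReal.mul_ne_top (by simp) (ENNReal.add_ne_top.2 ⟨h₁, h₂⟩)
  have heq := ae_eq_of_ae_le_of_lintegral_le hle hfin (by fun_prop) h
  rw [← Measure.withDensity_rnDeriv_eq μ₁ ν ac₁, ← Measure.withDensity_rnDeriv_eq μ₂ ν ac₂]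
  refine withDensity_congr_ae ?_
  filter_upwards [heq, hd, μ₁.rnDeriv_lt_top ν, μ₂.rnDeriv_lt_top ν] with x he hx c d
  rw [← ENNReal.toReal_eq_toReal_iff' c.ne d.ne]
  by_contra hne
  rw [hx, key _ _ ENNReal.toReal_nonneg ENNReal.toReal_nonneg] at he
  have hlt := InformationTheory.strictConvexOn_klFun.2
    (Set.mem_Ici.2 (ENNReal.toReal_nonneg (a := μ₁.rnDeriv ν x)))
    (Set.mem_Ici.2 (ENNReal.toReal_nonneg (a := μ₂.rnDeriv ν x))) hne
    (show (0 : ℝ) < 1 / 2 by norm_num) (show (0 : ℝ) < 1 / 2 by norm_num) (by norm_num)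
  simp only [smul_eq_mul] at hlt
  refine absurd he (ne_of_lt ((ENNReal.ofReal_lt_ofReal_iff_of_nonneg ?_).2 hlt))
  exact InformationTheory.klFun_nonneg (by positivity)

/-- For `β > 0`, if the (finite) entropic optimal transport infimum is attained by two
couplings `γ₁` and `γ₂`, then `γ₁ = γ₂`: the entropic optimal transport plan is unique. -/
theorem entOT_plan_unique {X : Type*} [MeasurableSpace X] [PseudoMetricSpace X]
    (β : ℝ) (hβ : 0 < β)
    (P Q : Measure X) [IsProbabilityMeasure P] [IsProbabilityMeasure Q]
    (hfin : Wbeta β P Q < ⊤)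
    (γ₁ γ₂ : Measure (X × X)) (h₁ : IsCoupling γ₁ P Q) (h₂ : IsCoupling γ₂ P Q)
    (hopt₁ : entOTObj β P Q γ₁ = Wbeta β P Q)
    (hopt₂ : entOTObj β P Q γ₂ = Wbeta β P Q) :
    γ₁ = γ₂ := by
  obtain ⟨p₁, a₁, b₁⟩ := h₁
  obtain ⟨p₂, a₂, b₂⟩ := h₂
  have two : (2 : ℝ≥0∞)⁻¹ * (1 + 1) = 1 := by
    rw [one_add_one_eq_two]; exact ENNReal.inv_mul_cancel (by simp) (by simp)
  have half : ∀ {α : Type _} [MeasurableSpace α] (R : Measure α),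
      (2 : ℝ≥0∞)⁻¹ • (R + R) = R := by
    intro α _ R
    ext s hs
    simp only [Measure.smul_apply, Measure.add_apply, smul_eq_mul]
    calc (2 : ℝ≥0∞)⁻¹ * (R s + R s) = ((2 : ℝ≥0∞)⁻¹ * (1 + 1)) * R s := by ring
      _ = R s := by rw [two, one_mul]
  have hp : IsProbabilityMeasure ((2 : ℝ≥0∞)⁻¹ • (γ₁ + γ₂)) := by
    constructor
    simpa [mul_add] using two
  have hc : IsCoupling ((2 : ℝ≥0∞)⁻¹ • (γ₁ + γ₂)) P Q := by
    refine ⟨hp, ?_, ?_⟩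
    · rw [Measure.map_smul, Measure.map_add _ _ measurable_fst, a₁, a₂, half]
    · rw [Measure.map_smul, Measure.map_add _ _ measurable_snd, b₁, b₂, half]
  have hW : Wbeta β P Q ≤ entOTObj β P Q ((2 : ℝ≥0∞)⁻¹ • (γ₁ + γ₂)) :=
    iInf₂_le (f := fun (γ : Measure (X × X)) (_ : γ ∈ {γ : Measure (X × X) | IsCoupling γ P Q}) =>
      entOTObj β P Q γ) _ hc
  have f₁ : entOTObj β P Q γ₁ ≠ ⊤ := hopt₁ ▸ hfin.ne
  have f₂ : entOTObj β P Q γ₂ ≠ ⊤ := hopt₂ ▸ hfin.ne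
  have hsum : Wbeta β P Q =
      (2 : ℝ≥0∞)⁻¹ * (entOTObj β P Q γ₁ + entOTObj β P Q γ₂) := by
    rw [hopt₁, hopt₂]
    calc Wbeta β P Q = ((2 : ℝ≥0∞)⁻¹ * (1 + 1)) * Wbeta β P Q := by rw [two, one_mul]
      _ = _ := by ring
  rw [hsum] at hW
  have hb0 : ENNReal.ofReal β ≠ 0 := by simpa using hβ
  simp only [entOTObj, KLdiv_eq_klDiv, lintegral_smul_measure, lintegral_add_measure,
    smul_eq_mul] at hW f₁ f₂
  obtain ⟨l₁, k₁⟩ := ENNReal.add_ne_top.1 f₁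
  obtain ⟨l₂, k₂⟩ := ENNReal.add_ne_top.1 f₂
  have aux : ∀ k : ℝ≥0∞, ENNReal.ofReal β * k ≠ ⊤ → k ≠ ⊤ := by
    rintro k hk rfl
    exact hk (ENNReal.mul_top hb0)
  refine eq_of_klDiv_midpoint γ₁ γ₂ (P.prod Q) (aux _ k₁) (aux _ k₂) ?_
  have lfin : (2 : ℝ≥0∞)⁻¹ * (∫⁻ p, edist p.1 p.2 ∂γ₁ + ∫⁻ p, edist p.1 p.2 ∂γ₂) ≠ ⊤ :=
    ENNReal.mul_ne_top (by simp) (ENNReal.add_ne_top.2 ⟨l₁, l₂⟩)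
  rw [← ENNReal.mul_le_mul_iff_right hb0 ENNReal.ofReal_ne_top,
    ← ENNReal.add_le_add_iff_left lfin]
  refine le_trans (le_of_eq ?_) hW
  ring

end
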